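/- For every integer n ≥ 3, every (n−1)-element subset s of Fin (n+1), and every 2-element subset e of Fin (n+1), the partial derivative of the Cayley–Menger polynomial Q_s with respect to the variable x_e, evaluated at the point where all variables equal 1, equals (2/(n−1)) · Q_s(1,…,1) if e ⊆ s, and equals 0 otherwise. Consequently, the Jacobian matrix of the family (Q_s) at the all-ones point equals c · M with c = (2/(n−1)) · Q(1,…,1), where Q(1,…,1) is the common value of the Q_s at the all-ones point. -/

import Mathlib

open Matrix Finset

/-- The (n-1)-element subsets of `Fin (n+1)`, indexing the codimension-2 faces
of an `n`-dimensional simplex. -/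
abbrev Faces (n : ℕ) := {s : Finset (Fin (n + 1)) // s.card = n - 1}

/-- The 2-element subsets of `Fin (n+1)`, indexing the edges of an
`n`-dimensional simplex. -/
abbrev Edges (n : ℕ) := {e : Finset (Fin (n + 1)) // e.card = 2}

/-- The face-edge incidence matrix over `ℚ`: entry `1` if the edge `e` is
contained in the face `s`, and `0` otherwise. -/
def M (n : ℕ) : Matrix (Faces n) (Edges n) ℚ :=
  fun s e => if e.val ⊆ s.val then 1 else 0

/-- The Cayley–Menger matrix of a subset `s` of `Fin (n+1)`, with rows and
columns indexed by `{*} ∪ s` (encoded as `Option ↥s`, with `none` the added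
basepoint `*`): the diagonal entries are `0`, the entries pairing the basepoint
with an element of `s` are `1`, and the entry for distinct `i, j ∈ s` is the
variable `x_{{i,j}}`. -/
noncomputable def cayleyMengerMatrix (n : ℕ) (s : Finset (Fin (n + 1))) :
    Matrix (Option {x // x ∈ s}) (Option {x // x ∈ s}) (MvPolynomial (Edges n) ℚ) :=
  fun i j =>
    match i, j with
    | none, none => 0
    | none, some _ => 1
    | some _, none => 1
    | some a, some b =>
      if h : a = b then 0
      else MvPolynomial.X ⟨{a.val, b.val}, Finset.card_pair fun hab => h (Subtype.ext hab)⟩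

/-- The Cayley–Menger polynomial `Q_s` of an (n-1)-element subset `s` of
`Fin (n+1)`: the determinant of the Cayley–Menger matrix of `s`. -/
noncomputable def Q (n : ℕ) (s : Faces n) : MvPolynomial (Edges n) ℚ :=
  (cayleyMengerMatrix n s.val).det

lemma derivation_prod {R B ι : Type*} [CommRing R] [CommRing B] [Algebra R B] [DecidableEq ι]
    (D : Derivation R B B) (f : ι → B) (t : Finset ι) :
    D (∏ i ∈ t, f i) = ∑ i ∈ t, (∏ j ∈ t.erase i, f j) * D (f i) := by
  induction t using Finset.induction_on with
  | empty => simp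
  | insert a t ha ih =>
    rw [Finset.prod_insert ha, Derivation.leibniz, ih, Finset.sum_insert ha,
      Finset.erase_insert ha, add_comm, smul_eq_mul, smul_eq_mul, Finset.mul_sum]
    congr 1
    refine Finset.sum_congr rfl fun i hi => ?_
    have hia : a ≠ i := by rintro rfl; exact ha hi
    rw [Finset.erase_insert_of_ne hia, Finset.prod_insert (by simp [ha]), mul_assoc]

lemma derivation_det {R B ι : Type*} [CommRing R] [CommRing B] [Algebra R B]
    [Fintype ι] [DecidableEq ι] (D : Derivation R B B) (A : Matrix ι ι B) :
    D A.det = ∑ j, ∑ i, A.adjugate j i * D (A i j) := by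
  have h1 : ∀ j, ∑ i, A.adjugate j i * D (A i j)
      = (A.updateCol j (fun i => D (A i j))).det := by
    intro j
    rw [← Matrix.cramer_apply, Matrix.cramer_eq_adjugate_mulVec]
    rfl
  simp_rw [h1, Matrix.det_apply]
  rw [map_sum, Finset.sum_comm]
  refine Finset.sum_congr rfl fun σ _ => ?_
  rw [← Finset.smul_sum]
  have h2 : ∀ (u : ℤˣ) (b : B), D (u • b) = u • D b := by
    intro u b
    rcases Int.units_eq_one_or u with rfl | rfl <;> simp
  rw [h2, derivation_prod]
  congr 1
  refine Finset.sum_congr rfl fun j _ => ?_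
  rw [← Finset.mul_prod_erase Finset.univ _ (Finset.mem_univ j), mul_comm]
  congr 1
  · simp
  · refine Finset.prod_congr rfl fun k hk => ?_
    rw [Matrix.updateCol_ne (Finset.ne_of_mem_erase hk)]

/-- The Cayley–Menger matrix at the all-ones point. -/
def onesMat (ι : Type*) [DecidableEq ι] : Matrix ι ι ℚ := fun i j => if i = j then 0 else 1

lemma onesMat_mul (ι : Type*) [Fintype ι] [DecidableEq ι] :
    onesMat ι * Matrix.of (fun i j : ι => if i = j then 2 - (Fintype.card ι : ℚ) else 1)
      = ((Fintype.card ι : ℚ) - 1) • (1 : Matrix ι ι ℚ) := by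
  ext i j
  have h : ∀ k, onesMat ι i k * (if k = j then 2 - (Fintype.card ι : ℚ) else 1)
      = 1 - (if i = k then 1 else 0) + (1 - (Fintype.card ι : ℚ)) * (if k = j then 1 else 0)
        - (1 - (Fintype.card ι : ℚ)) * (if i = k then (if k = j then 1 else 0) else 0) := by
    intro k
    unfold onesMat
    split_ifs <;> ring
  rw [Matrix.mul_apply]
  simp only [Matrix.of_apply]
  simp_rw [h, Finset.sum_sub_distrib, Finset.sum_add_distrib, Finset.sum_sub_distrib,
    ← Finset.mul_sum]
  simp only [Finset.sum_ite_eq, Finset.sum_ite_eq', Finset.mem_univ, if_true, Finset.sum_const,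
    Finset.card_univ, Matrix.smul_apply, Matrix.one_apply, nsmul_eq_mul, smul_eq_mul]
  split_ifs <;> ring

lemma onesMat_adjugate (ι : Type*) [Fintype ι] [DecidableEq ι] (i j : ι) (hij : i ≠ j) :
    ((Fintype.card ι : ℚ) - 1) * (onesMat ι).adjugate i j = (onesMat ι).det := by
  have h := congrArg (fun X => (onesMat ι).adjugate * X) (onesMat_mul ι)
  simp only [← Matrix.mul_assoc, Matrix.adjugate_mul] at h
  have h2 := congrFun (congrFun h i) j
  simp [hij] at h2
  exact h2.symm

lemma eval_cmMatrix (n : ℕ) (s : Finset (Fin (n + 1))) :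
    (MvPolynomial.eval (fun _ => (1 : ℚ))).mapMatrix (cayleyMengerMatrix n s)
      = onesMat (Option {x // x ∈ s}) := by
  ext i j
  rcases i with _ | a <;> rcases j with _ | b <;>
    simp [cayleyMengerMatrix, onesMat]
  split_ifs <;> simp

lemma eval_Q (n : ℕ) (s : Faces n) :
    MvPolynomial.eval (fun _ => (1 : ℚ)) (Q n s) = (onesMat (Option {x // x ∈ s.val})).det := by
  rw [Q, RingHom.map_det, eval_cmMatrix]

lemma eval_Q_eq (n : ℕ) (s t : Faces n) :
    MvPolynomial.eval (fun _ => (1 : ℚ)) (Q n s) =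
      MvPolynomial.eval (fun _ => (1 : ℚ)) (Q n t) := by
  rw [eval_Q, eval_Q]
  have hc : Fintype.card (Option {x // x ∈ s.val}) = Fintype.card (Option {x // x ∈ t.val}) := by
    simp [s.2, t.2]
  rw [← Matrix.det_submatrix_equiv_self (Fintype.equivOfCardEq hc)]
  congr 1
  ext i j
  simp [onesMat]

lemma eval_pderiv_Q (n : ℕ) (hn : 3 ≤ n) (s : Faces n) (e : Edges n) :
    MvPolynomial.eval (fun _ => (1 : ℚ)) (MvPolynomial.pderiv e (Q n s)) =
      if e.val ⊆ s.val then
        2 / ((n : ℚ) - 1) * MvPolynomial.eval (fun _ => (1 : ℚ)) (Q n s)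
      else 0 := by
  have hn' : (n : ℚ) - 1 ≠ 0 := by
    have : (3 : ℚ) ≤ n := by exact_mod_cast hn
    linarith
  have hcard : (Fintype.card (Option {x // x ∈ s.val}) : ℚ) = n := by
    have : Fintype.card (Option {x // x ∈ s.val}) = n := by
      simp [s.2]; omega
    rw [this]
  have hadj : ∀ i j : Option {x // x ∈ s.val}, i ≠ j →
      (onesMat (Option {x // x ∈ s.val})).adjugate i j
        = (onesMat (Option {x // x ∈ s.val})).det / ((n : ℚ) - 1) := by
    intro i j hij
    rw [eq_div_iff hn', mul_comm, ← onesMat_adjugate _ i j hij, hcard]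
  rw [eval_Q, Q, derivation_det, map_sum]
  simp_rw [map_sum, map_mul]
  have h1 : ∀ i j, MvPolynomial.eval (fun _ => (1 : ℚ))
      ((cayleyMengerMatrix n s.val).adjugate i j)
      = (onesMat (Option {x // x ∈ s.val})).adjugate i j := by
    intro i j
    rw [← eval_cmMatrix, ← RingHom.map_adjugate]
    rfl
  simp_rw [h1]
  have h2 : ∀ i j : Option {x // x ∈ s.val},
      (onesMat (Option {x // x ∈ s.val})).adjugate i j *
        MvPolynomial.eval (fun _ => (1 : ℚ))
          (MvPolynomial.pderiv e (cayleyMengerMatrix n s.val j i))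
      = match i, j with
        | some a, some b => if a ≠ b ∧ ({b.val, a.val} : Finset (Fin (n + 1))) = e.val then
            (onesMat (Option {x // x ∈ s.val})).det / ((n : ℚ) - 1) else 0
        | _, _ => 0 := by
    intro i j
    rcases i with _ | a <;> rcases j with _ | b <;> simp only [cayleyMengerMatrix]
    · simp
    · simp
    · simp
    · by_cases hab : b = a
      · simp [hab]
      · have hab' : a ≠ b := fun h => hab h.symm
        rw [dif_neg hab, hadj _ _ (by simpa using hab'), MvPolynomial.pderiv_X]
        by_cases he : ({b.val, a.val} : Finset (Fin (n + 1))) = e.val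
        · rw [if_pos ⟨hab', he⟩]
          have : (⟨{b.val, a.val}, Finset.card_pair fun h => hab (Subtype.ext h)⟩ : Edges n)
            = e := Subtype.ext he
          rw [this]; simp
        · rw [if_neg (fun h => he h.2), Pi.single_eq_of_ne]
          · simp
          · intro h
            exact he (congrArg Subtype.val h)
  simp_rw [h2, Fintype.sum_option]
  simp only [Finset.sum_const_zero, zero_add]
  split_ifs with hes
  · obtain ⟨x, y, hxy, hxye⟩ := Finset.card_eq_two.mp e.2
    have hx : x ∈ s.val := hes (by simp [hxye])
    have hy : y ∈ s.val := hes (by simp [hxye])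
    have h3 : ∀ a b : {x // x ∈ s.val},
        (if a ≠ b ∧ ({b.val, a.val} : Finset (Fin (n + 1))) = e.val then
            (onesMat (Option {x // x ∈ s.val})).det / ((n : ℚ) - 1) else 0)
        = (if a = ⟨x, hx⟩ then (if b = ⟨y, hy⟩ then
            (onesMat (Option {x // x ∈ s.val})).det / ((n : ℚ) - 1) else 0) else 0)
          + (if a = ⟨y, hy⟩ then (if b = ⟨x, hx⟩ then
            (onesMat (Option {x // x ∈ s.val})).det / ((n : ℚ) - 1) else 0) else 0) := by
      rintro ⟨a, ha⟩ ⟨b, hb⟩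
      have h4 : (a ≠ b ∧ ({b, a} : Finset (Fin (n + 1))) = e.val) ↔
          (a = x ∧ b = y) ∨ (a = y ∧ b = x) := by
        rw [hxye]
        constructor
        · rintro ⟨h, h'⟩
          have ha' : a ∈ ({x, y} : Finset (Fin (n + 1))) := by rw [← h']; simp
          have hb' : b ∈ ({x, y} : Finset (Fin (n + 1))) := by rw [← h']; simp
          simp only [Finset.mem_insert, Finset.mem_singleton] at ha' hb'
          grind
        · rintro (⟨rfl, rfl⟩ | ⟨rfl, rfl⟩)
          · exact ⟨hxy, Finset.pair_comm _ _⟩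
          · exact ⟨hxy.symm, rfl⟩
      simp only [ne_eq, Subtype.mk.injEq] at h4 ⊢
      simp only [h4]
      by_cases h5 : a = x <;> by_cases h6 : b = y <;> by_cases h7 : a = y <;>
        by_cases h8 : b = x <;> simp_all
    simp_rw [h3, Finset.sum_add_distrib]
    simp
    ring
  · refine Finset.sum_eq_zero fun a _ => Finset.sum_eq_zero fun b _ => ?_
    rw [if_neg]
    rintro ⟨_, h⟩
    apply hes
    rw [← h]
    intro z hz
    simp only [Finset.mem_insert, Finset.mem_singleton] at hz
    rcases hz with rfl | rfl
    · exact b.2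
    · exact a.2

/-- For every `n ≥ 3`, every (n-1)-element subset `s` and every 2-element
subset `e` of `Fin (n+1)`, the partial derivative `∂Q_s/∂x_e` evaluated at the
all-ones point equals `(2/(n-1)) · Q_s(1,…,1)` if `e ⊆ s` and `0` otherwise;
moreover the value `Q_s(1,…,1)` is the same for all `s`, and consequently the
Jacobian matrix of the family `(Q_s)` at the all-ones point equals `c • M`,
where `c = (2/(n-1)) · Q(1,…,1)` is defined via this common value. -/
theorem jacobian_cayleyMenger (n : ℕ) (hn : 3 ≤ n) :
    (∀ (s : Faces n) (e : Edges n),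
        MvPolynomial.eval (fun _ => (1 : ℚ)) (MvPolynomial.pderiv e (Q n s)) =
          if e.val ⊆ s.val then
            2 / ((n : ℚ) - 1) * MvPolynomial.eval (fun _ => (1 : ℚ)) (Q n s)
          else 0) ∧
      (∀ s t : Faces n,
        MvPolynomial.eval (fun _ => (1 : ℚ)) (Q n s) =
          MvPolynomial.eval (fun _ => (1 : ℚ)) (Q n t)) ∧
      (∀ s₀ : Faces n,
        (fun (s : Faces n) (e : Edges n) =>
            MvPolynomial.eval (fun _ => (1 : ℚ)) (MvPolynomial.pderiv e (Q n s))) =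
          (2 / ((n : ℚ) - 1) * MvPolynomial.eval (fun _ => (1 : ℚ)) (Q n s₀)) • M n) := by
  refine ⟨eval_pderiv_Q n hn, eval_Q_eq n, fun s₀ => ?_⟩
  funext s e
  rw [eval_pderiv_Q n hn, eval_Q_eq n s s₀, Matrix.smul_apply, M, smul_eq_mul]
  split_ifs <;> simp
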